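/- Let ρ be a Borel probability measure on ℝ^d × ℝ, M ≥ 1 with |y| ≤ M for ρ-almost every (x,y), and let f_ρ : ℝ^d → ℝ be a version of the conditional expectation of y given x under ρ with |f_ρ(x)| ≤ M for all x. Let z = ((x_1,y_1),…,(x_N,y_N)) be a sample with |y_i| ≤ M for every i. Let σ* > 0, q ∈ (0,1), γ > 0, N_sv a positive integer, κ ≥ 1 a constant bounding the Gaussian kernel values, and set λ = ((1−q)/κ²)^{q/(2−q)} γ^{2/(2−q)}. Let f_{z,λ} be any minimizer of E_z(f) + λ R₀(f) over F_{N_sv}, let g : ℝ^d → ℝ be any function with f_{z,γ}(·) = (1/N) Σ_{i=1}^N g(x_i) exp(−σ*‖· − x_i‖²), and let β¹ ∈ ℝ^N be any minimizer of E_z(Σ_i β_i exp(−σ*‖· − x_i‖²)) + γ Σ_i |β_i| (assume all minimizers exist). Then E_ρ(π_M(f_{z,λ})) − E_ρ(f_ρ) + λ R₀(f_{z,λ}) ≤ S₁ + S₂ + γ N^{1−q}(Σ_{i=1}^N |β¹_i|)^q, where S₁ = [E_ρ(π_M(f_{z,λ})) − E_z(π_M(f_{z,λ}))] + [E_z(f_{z,γ})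 − E_ρ(f_{z,γ})] and S₂ = E_ρ(f_{z,γ}) + (γ/N) Σ_{i=1}^N |g(x_i)| − E_ρ(f_ρ). -/

import Mathlib

open Finset

/-- The function `t ↦ Σ_k Σ_i α_{k,i} exp(−θ_k ‖t − x_i‖²)` represented by bandwidths
`θ` and coefficients `α`, anchored at the points `x_1, …, x_N`. -/
noncomputable def repFun {d N : ℕ} (x : Fin N → EuclideanSpace ℝ (Fin d)) {m : ℕ}
    (θ : Fin m → ℝ) (α : Fin m → Fin N → ℝ) : EuclideanSpace ℝ (Fin d) → ℝ :=
  fun t => ∑ k, ∑ i, α k i * Real.exp (-(θ k) * ‖t - x i‖ ^ 2)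

/-- `IsRep x f m θ α` : `(m, θ, α)` is a representation of `f` with positive
bandwidths, anchored at the points `x`. -/
def IsRep {d N : ℕ} (x : Fin N → EuclideanSpace ℝ (Fin d))
    (f : EuclideanSpace ℝ (Fin d) → ℝ) (m : ℕ) (θ : Fin m → ℝ)
    (α : Fin m → Fin N → ℝ) : Prop :=
  (∀ k, 0 < θ k) ∧ f = repFun x θ α

/-- Membership in the class `F` of functions admitting some representation. -/
def InF {d N : ℕ} (x : Fin N → EuclideanSpace ℝ (Fin d))
    (f : EuclideanSpace ℝ (Fin d) → ℝ) : Prop :=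
  ∃ m θ α, IsRep x f m θ α

/-- Membership in the subclass `F_{N_sv}` of functions admitting a representation
with at most `Nsv` bandwidths. -/
def InFsv {d N : ℕ} (x : Fin N → EuclideanSpace ℝ (Fin d)) (Nsv : ℕ)
    (f : EuclideanSpace ℝ (Fin d) → ℝ) : Prop :=
  ∃ m, m ≤ Nsv ∧ ∃ (θ : Fin m → ℝ) (α : Fin m → Fin N → ℝ), IsRep x f m θ α

/-- The sparsity measure `R₀(f)`: the minimal number of nonzero coefficients over
all representations of `f`. -/
noncomputable def R0 {d N : ℕ} (x : Fin N → EuclideanSpace ℝ (Fin d))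
    (f : EuclideanSpace ℝ (Fin d) → ℝ) : ℕ :=
  sInf {n : ℕ | ∃ m θ α, IsRep x f m θ α ∧
    ({p : Fin m × Fin N | α p.1 p.2 ≠ 0} : Set (Fin m × Fin N)).ncard = n}

/-- The empirical error `E_z(f) = (1/N) Σ_i (f(x_i) − y_i)²`. -/
noncomputable def empErr {d N : ℕ} (x : Fin N → EuclideanSpace ℝ (Fin d))
    (y : Fin N → ℝ) (f : EuclideanSpace ℝ (Fin d) → ℝ) : ℝ :=
  (1 / N : ℝ) * ∑ i, (f (x i) - y i) ^ 2

open MeasureTheory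

/-- The generalization error `E_ρ(f) = ∫ (f(x) − y)² dρ(x,y)`. -/
noncomputable def genErr {d : ℕ}
    (ρ : Measure (EuclideanSpace ℝ (Fin d) × ℝ))
    (f : EuclideanSpace ℝ (Fin d) → ℝ) : ℝ :=
  ∫ p, (f p.1 - p.2) ^ 2 ∂ρ

/-- The projection `π_M(t) = max(−M, min(t, M))`. -/
noncomputable def proj (M t : ℝ) : ℝ := max (-M) (min t M)

lemma aux_scal (q G P C : ℝ) (hq0 : 0 < q)
    (h : ∀ t : ℝ, 0 ≤ t → G ≤ (t - 1) ^ 2 * P + (t - 1) * C + G * t ^ q) :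
    (1 - q) * G ≤ P := by
  have hd : HasDerivAt (fun t : ℝ => (t - 1) ^ 2 * P + (t - 1) * C + G * t ^ q)
      (C + G * q) 1 := by
    have h1 : HasDerivAt (fun t : ℝ => t - 1) 1 1 := (hasDerivAt_id (1 : ℝ)).sub_const 1
    have h2 : HasDerivAt (fun t : ℝ => t ^ q) (q * (1 : ℝ) ^ (q - 1)) 1 :=
      Real.hasDerivAt_rpow_const (Or.inl one_ne_zero)
    have := (((h1.pow 2).mul_const P).add (h1.mul_const C)).add (h2.const_mul G)
    exact this.congr_deriv (by simp)
  have hm : IsLocalMin (fun t : ℝ => (t - 1) ^ 2 * P + (t - 1) * C + G * t ^ q) 1 := by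
    filter_upwards [Ioi_mem_nhds (zero_lt_one : (0 : ℝ) < 1)] with t ht
    simpa using h t (le_of_lt ht)
  have h0 := hm.hasDerivAt_eq_zero hd
  have h3 := h 0 le_rfl
  rw [Real.zero_rpow hq0.ne'] at h3
  linarith

lemma aux_holder {N : ℕ} (q : ℝ) (hq0 : 0 < q) (hq1 : q < 1) (β : Fin N → ℝ) :
    ∑ i, |β i| ^ q ≤ (N : ℝ) ^ (1 - q) * (∑ i, |β i|) ^ q := by
  have h1 : (1 : ℝ) ≤ 1 / q := by rw [le_div_iff₀ hq0]; linarith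
  have h := Real.rpow_sum_le_const_mul_sum_rpow (Finset.univ : Finset (Fin N))
    (fun i => |β i| ^ q) h1
  have e : ∀ i, |(|β i| ^ q)| = |β i| ^ q := fun i => abs_of_nonneg (by positivity)
  have e2 : ∀ i, (|β i| ^ q) ^ (1 / q) = |β i| := fun i => by
    rw [← Real.rpow_mul (abs_nonneg _), mul_one_div_cancel hq0.ne', Real.rpow_one]
  simp only [e, e2, Finset.card_univ, Fintype.card_fin] at h
  have hS : 0 ≤ ∑ i, |β i| ^ q := Finset.sum_nonneg fun i _ => by positivity
  have hT : 0 ≤ ∑ i, |β i| := Finset.sum_nonneg fun i _ => by positivity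
  have h2 := Real.rpow_le_rpow (by positivity) h hq0.le
  rw [← Real.rpow_mul hS, one_div_mul_cancel hq0.ne', Real.rpow_one,
    Real.mul_rpow (by positivity) hT, ← Real.rpow_mul (by positivity)] at h2
  have e3 : (1 / q - 1) * q = 1 - q := by field_simp
  rwa [e3] at h2

lemma aux_exists {N : ℕ} (q γ : ℝ) (hq0 : 0 < q) (hγ : 0 < γ)
    (E : (Fin N → ℝ) → ℝ) (hE : Continuous E) (hE0 : ∀ β, 0 ≤ E β) :
    ∃ β : Fin N → ℝ, ∀ b : Fin N → ℝ,
      E β + γ * ∑ i, |β i| ^ q ≤ E b + γ * ∑ i, |b i| ^ q := by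
  have hz : ∑ i : Fin N, |(0 : Fin N → ℝ) i| ^ q = 0 := by simp [Real.zero_rpow hq0.ne']
  have hD : 0 ≤ E 0 / γ := div_nonneg (hE0 0) hγ.le
  set R := (E 0 / γ) ^ (1 / q) with hR
  have hR0 : 0 ≤ R := by positivity
  have hc : Continuous (fun β : Fin N → ℝ => E β + γ * ∑ i, |β i| ^ q) := by
    refine hE.add (continuous_const.mul (continuous_finsetSum _ fun i _ => ?_))
    exact (continuous_apply i).abs.rpow_const fun _ => Or.inr hq0.le
  obtain ⟨β, -, hβ⟩ := (isCompact_closedBall (0 : Fin N → ℝ) R).exists_isMinOn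
    ⟨0, by simpa using hR0⟩ hc.continuousOn
  refine ⟨β, fun b => ?_⟩
  by_cases hb : b ∈ Metric.closedBall (0 : Fin N → ℝ) R
  · exact hβ hb
  · have h0 : E β + γ * ∑ i, |β i| ^ q ≤ E 0 + γ * ∑ i, |(0 : Fin N → ℝ) i| ^ q :=
      hβ (by simpa using hR0)
    rw [hz, mul_zero, add_zero] at h0
    rw [mem_closedBall_zero_iff, pi_norm_le_iff_of_nonneg hR0] at hb
    push Not at hb
    obtain ⟨i, hi⟩ := hb
    rw [Real.norm_eq_abs] at hi
    have h1 : R ^ q ≤ |b i| ^ q := Real.rpow_le_rpow hR0 hi.le hq0.le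
    rw [hR, ← Real.rpow_mul hD, one_div_mul_cancel hq0.ne', Real.rpow_one, div_le_iff₀ hγ] at h1
    have h2 : |b i| ^ q ≤ ∑ i, |b i| ^ q :=
      Finset.single_le_sum (f := fun i => |b i| ^ q) (fun i _ => by positivity)
        (Finset.mem_univ i)
    have := hE0 b
    nlinarith [mul_le_mul_of_nonneg_left h2 hγ.le]

/-- the Gaussian combination with a single bandwidth -/
noncomputable def gcomb {d N : ℕ} (x : Fin N → EuclideanSpace ℝ (Fin d)) (σ : ℝ)
    (β : Fin N → ℝ) : EuclideanSpace ℝ (Fin d) → ℝ :=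
  fun t => ∑ i, β i * Real.exp (-σ * ‖t - x i‖ ^ 2)

lemma aux_lower {d N : ℕ} (hN : 0 < N) (x : Fin N → EuclideanSpace ℝ (Fin d)) (y : Fin N → ℝ)
    (σ q γ : ℝ) (hσ : 0 < σ) (hq0 : 0 < q) (β : Fin N → ℝ)
    (hβ : ∀ b : Fin N → ℝ, empErr x y (gcomb x σ β) + γ * ∑ i, |β i| ^ q ≤
      empErr x y (gcomb x σ b) + γ * ∑ i, |b i| ^ q) (i : Fin N) :
    (1 - q) * (γ * |β i| ^ q) ≤ |β i| ^ 2 := by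
  have hN' : (0 : ℝ) < N := by exact_mod_cast hN
  set v : Fin N → ℝ := fun j => β i * Real.exp (-σ * ‖x j - x i‖ ^ 2) with hv
  set r : Fin N → ℝ := fun j => gcomb x σ β (x j) - y j with hr
  have key := aux_scal q (γ * |β i| ^ q) ((1 / N : ℝ) * ∑ j, v j ^ 2)
    ((1 / N : ℝ) * ∑ j, 2 * r j * v j) hq0 (fun t ht => by
      have h := hβ (Function.update β i (t * β i))
      have e1 : ∀ s, gcomb x σ (Function.update β i (t * β i)) s =
          gcomb x σ β s + (t - 1) * (β i * Real.exp (-σ * ‖s - x i‖ ^ 2)) := by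
        intro s
        unfold gcomb
        rw [← Finset.add_sum_erase _ _ (Finset.mem_univ i),
          ← Finset.add_sum_erase univ (fun k => β k * _) (Finset.mem_univ i)]
        have : ∑ k ∈ univ.erase i, Function.update β i (t * β i) k *
            Real.exp (-σ * ‖s - x k‖ ^ 2) =
            ∑ k ∈ univ.erase i, β k * Real.exp (-σ * ‖s - x k‖ ^ 2) :=
          Finset.sum_congr rfl fun k hk => by
            rw [Function.update_of_ne (Finset.ne_of_mem_erase hk)]
        rw [this, Function.update_self]
        ring
      have e2 : ∑ k, |Function.update β i (t * β i) k| ^ q =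
          ∑ k, |β k| ^ q + (t ^ q * |β i| ^ q - |β i| ^ q) := by
        rw [← Finset.add_sum_erase _ _ (Finset.mem_univ i),
          ← Finset.add_sum_erase univ (fun k => |β k| ^ q) (Finset.mem_univ i)]
        have : ∑ k ∈ univ.erase i, |Function.update β i (t * β i) k| ^ q =
            ∑ k ∈ univ.erase i, |β k| ^ q :=
          Finset.sum_congr rfl fun k hk => by
            rw [Function.update_of_ne (Finset.ne_of_mem_erase hk)]
        rw [this, Function.update_self, abs_mul, abs_of_nonneg ht,
          Real.mul_rpow ht (abs_nonneg _)]
        ring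
      have e3 : empErr x y (gcomb x σ (Function.update β i (t * β i))) =
          empErr x y (gcomb x σ β) + (t - 1) ^ 2 * ((1 / N : ℝ) * ∑ j, v j ^ 2) +
            (t - 1) * ((1 / N : ℝ) * ∑ j, 2 * r j * v j) := by
        unfold empErr
        simp only [e1, Finset.mul_sum]
        rw [← Finset.sum_add_distrib, ← Finset.sum_add_distrib]
        refine Finset.sum_congr rfl fun j _ => ?_
        simp only [hr, hv]
        ring
      rw [e2, e3] at h
      linarith)
  refine key.trans ?_
  have h1 : ∑ j, v j ^ 2 ≤ ∑ _j : Fin N, |β i| ^ 2 := by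
    refine Finset.sum_le_sum fun j _ => ?_
    simp only [hv]
    rw [mul_pow, sq_abs]
    refine mul_le_of_le_one_right (sq_nonneg _) ?_
    refine pow_le_one₀ (Real.exp_pos _).le (Real.exp_le_one_iff.2 ?_)
    have : 0 ≤ σ * ‖x j - x i‖ ^ 2 := by positivity
    linarith
  rw [Finset.sum_const, Finset.card_univ, Fintype.card_fin, nsmul_eq_mul] at h1
  calc (1 / N : ℝ) * ∑ j, v j ^ 2 ≤ (1 / N : ℝ) * (N * |β i| ^ 2) := by gcongr
    _ = |β i| ^ 2 := by field_simp

lemma aux_lam (q γ κ b : ℝ) (hq0 : 0 < q) (hq1 : q < 1) (hγ : 0 < γ) (hκ : 1 ≤ κ)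
    (hb : 0 < b) (h : (1 - q) * (γ * b ^ q) ≤ b ^ 2) :
    ((1 - q) / κ ^ 2) ^ (q / (2 - q)) * γ ^ (2 / (2 - q)) ≤ γ * b ^ q := by
  have h2q : 0 < 2 - q := by linarith
  have h1q : 0 < 1 - q := by linarith
  have hbq : 0 < b ^ q := Real.rpow_pos_of_pos hb q
  have h1 : (1 - q) * γ ≤ b ^ (2 - q) := by
    rw [Real.rpow_sub hb, le_div_iff₀ hbq, Real.rpow_two]; linarith
  have h2 : (1 - q) / κ ^ 2 ≤ 1 - q := div_le_self h1q.le (one_le_pow₀ hκ)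
  have h3 : (1 - q) / κ ^ 2 * γ ≤ b ^ (2 - q) :=
    (mul_le_mul_of_nonneg_right h2 hγ.le).trans h1
  have h4 := Real.rpow_le_rpow (by positivity) h3 (show 0 ≤ q / (2 - q) by positivity)
  rw [Real.mul_rpow (by positivity) hγ.le, ← Real.rpow_mul hb.le,
    mul_div_cancel₀ _ h2q.ne'] at h4
  have e : γ ^ (2 / (2 - q)) = γ * γ ^ (q / (2 - q)) := by
    rw [← Real.rpow_one_add' hγ.le (by positivity)]
    congr 1
    field_simp
    ring
  rw [e]
  nlinarith [mul_le_mul_of_nonneg_left h4 hγ.le]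

lemma aux_rep {d N : ℕ} (x : Fin N → EuclideanSpace ℝ (Fin d)) (σ : ℝ) (hσ : 0 < σ)
    (β : Fin N → ℝ) : IsRep x (gcomb x σ β) 1 (fun _ => σ) (fun _ => β) :=
  ⟨fun _ => hσ, by funext t; simp [gcomb, repFun]⟩

lemma aux_R0 {d N : ℕ} (x : Fin N → EuclideanSpace ℝ (Fin d)) (σ : ℝ) (hσ : 0 < σ)
    (β : Fin N → ℝ) : R0 x (gcomb x σ β) ≤ (univ.filter fun i => β i ≠ 0).card := by
  unfold R0
  refine Nat.sInf_le ⟨1, _, _, aux_rep x σ hσ β, ?_⟩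
  rw [← Set.ncard_coe_finset]
  refine Set.ncard_congr (fun p _ => p.2) ?_ ?_ ?_
  · rintro ⟨a, b⟩ h; simpa using h
  · rintro ⟨a, b⟩ ⟨a', b'⟩ _ _ h
    exact Prod.ext (Subsingleton.elim _ _) h
  · intro b hb; exact ⟨(0, b), by simpa using hb, rfl⟩

lemma aux_proj (M t y : ℝ) (hy : |y| ≤ M) : (proj M t - y) ^ 2 ≤ (t - y) ^ 2 := by
  obtain ⟨h1, h2⟩ := abs_le.1 hy
  unfold proj
  rcases le_total t M with h | h
  · rw [min_eq_left h]
    rcases le_total (-M) t with h' | h'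
    · rw [max_eq_right h']
    · rw [max_eq_left h']; nlinarith
  · rw [min_eq_right h, max_eq_right (by linarith)]; nlinarith

/-- Error decomposition for the `ℓ₀`-regularized minimizer:
`E_ρ(π_M(f_{z,λ})) − E_ρ(f_ρ) + λ R₀(f_{z,λ}) ≤ S₁ + S₂ + γ N^{1−q} (Σ_i |β¹_i|)^q`. -/
theorem error_decomposition
    (d N : ℕ) (hd : 0 < d) (hN : 0 < N)
    (ρ : Measure (EuclideanSpace ℝ (Fin d) × ℝ)) [IsProbabilityMeasure ρ]
    (M : ℝ) (hM : 1 ≤ M)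
    (hybound : ∀ᵐ p ∂ρ, |p.2| ≤ M)
    (fρ : EuclideanSpace ℝ (Fin d) → ℝ)
    (hfρ : (fun p : EuclideanSpace ℝ (Fin d) × ℝ => fρ p.1) =ᵐ[ρ]
      ρ[(fun p : EuclideanSpace ℝ (Fin d) × ℝ => p.2) |
        MeasurableSpace.comap Prod.fst (by infer_instance)])
    (hfρbound : ∀ t, |fρ t| ≤ M)
    (x : Fin N → EuclideanSpace ℝ (Fin d)) (y : Fin N → ℝ)
    (hyM : ∀ i, |y i| ≤ M)
    (σ : ℝ) (hσ : 0 < σ) (q : ℝ) (hq0 : 0 < q) (hq1 : q < 1)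
    (γ : ℝ) (hγ : 0 < γ) (Nsv : ℕ) (hNsv : 0 < Nsv)
    (κ : ℝ) (hκ : 1 ≤ κ)
    (hker : ∀ s : ℝ, 0 < s → ∀ u v : EuclideanSpace ℝ (Fin d),
      |Real.exp (-s * ‖u - v‖ ^ 2)| ≤ κ ^ 2)
    (lam : ℝ)
    (hlam : lam = ((1 - q) / κ ^ 2) ^ (q / (2 - q)) * γ ^ (2 / (2 - q)))
    (fzl : EuclideanSpace ℝ (Fin d) → ℝ)
    (hfzl : InFsv x Nsv fzl)
    (hfzlmin : ∀ f : EuclideanSpace ℝ (Fin d) → ℝ, InFsv x Nsv f →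
      empErr x y fzl + lam * (R0 x fzl : ℝ) ≤ empErr x y f + lam * (R0 x f : ℝ))
    (g : EuclideanSpace ℝ (Fin d) → ℝ)
    (fzg : EuclideanSpace ℝ (Fin d) → ℝ)
    (hfzg : fzg = fun t => (1 / N : ℝ) * ∑ i, g (x i) * Real.exp (-σ * ‖t - x i‖ ^ 2))
    (β1 : Fin N → ℝ)
    (hβ1 : ∀ β : Fin N → ℝ,
      empErr x y (fun t => ∑ i, β1 i * Real.exp (-σ * ‖t - x i‖ ^ 2)) + γ * ∑ i, |β1 i| ≤
        empErr x y (fun t => ∑ i, β i * Real.exp (-σ * ‖t - x i‖ ^ 2)) + γ * ∑ i, |β i|) :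
    genErr ρ (fun t => proj M (fzl t)) - genErr ρ fρ + lam * (R0 x fzl : ℝ) ≤
      ((genErr ρ (fun t => proj M (fzl t)) - empErr x y (fun t => proj M (fzl t))) +
        (empErr x y fzg - genErr ρ fzg)) +
      (genErr ρ fzg + (γ / N) * ∑ i, |g (x i)| - genErr ρ fρ) +
      γ * (N : ℝ) ^ (1 - q) * (∑ i, |β1 i|) ^ q := by
  have hN' : (0 : ℝ) < N := by exact_mod_cast hN
  have hlam0 : 0 ≤ lam := by
    rw [hlam]
    have : 0 < 1 - q := by linarith
    positivity
  have hproj : empErr x y (fun t => proj M (fzl t)) ≤ empErr x y fzl := by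
    unfold empErr
    exact mul_le_mul_of_nonneg_left
      (Finset.sum_le_sum fun i _ => aux_proj M _ _ (hyM i)) (by positivity)
  have hcont : Continuous fun β : Fin N → ℝ => empErr x y (gcomb x σ β) := by
    unfold empErr gcomb
    fun_prop
  have hnn : ∀ β : Fin N → ℝ, 0 ≤ empErr x y (gcomb x σ β) := fun β => by
    unfold empErr
    positivity
  obtain ⟨β, hβ⟩ := aux_exists q γ hq0 hγ _ hcont hnn
  have hR : lam * (R0 x (gcomb x σ β) : ℝ) ≤ γ * ∑ i, |β i| ^ q := by
    have h1 : (R0 x (gcomb x σ β) : ℝ) ≤ ((univ.filter fun i => β i ≠ 0).card : ℝ) := by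
      exact_mod_cast aux_R0 x σ hσ β
    have h2 : ((univ.filter fun i => β i ≠ 0).card : ℝ) * lam ≤
        ∑ i ∈ univ.filter (fun i => β i ≠ 0), γ * |β i| ^ q := by
      rw [← nsmul_eq_mul]
      refine Finset.card_nsmul_le_sum _ _ _ fun i hi => ?_
      have hi' : β i ≠ 0 := by simpa using hi
      rw [hlam]
      exact aux_lam q γ κ _ hq0 hq1 hγ hκ (abs_pos.2 hi')
        (aux_lower hN x y σ q γ hσ hq0 β hβ i)
    have h3 : ∑ i ∈ univ.filter (fun i => β i ≠ 0), γ * |β i| ^ q ≤ ∑ i, γ * |β i| ^ q :=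
      Finset.sum_le_sum_of_subset_of_nonneg (Finset.filter_subset _ _)
        fun i _ _ => by positivity
    rw [← Finset.mul_sum univ] at h3
    nlinarith [mul_le_mul_of_nonneg_left h1 hlam0]
  have hmin := hfzlmin _ ⟨1, hNsv, _, _, aux_rep x σ hσ β⟩
  have hb1 := hβ β1
  have hhol := mul_le_mul_of_nonneg_left (aux_holder q hq0 hq1 β1) hγ.le
  have hg := hβ1 (fun i => (1 / N : ℝ) * g (x i))
  have eg : (fun t => ∑ i, (1 / N : ℝ) * g (x i) * Real.exp (-σ * ‖t - x i‖ ^ 2)) = fzg := by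
    rw [hfzg]
    funext t
    simp only [Finset.mul_sum, mul_assoc]
  have eg2 : γ * ∑ i, |(1 / N : ℝ) * g (x i)| = (γ / N) * ∑ i, |g (x i)| := by
    have : ∀ i, |(1 / N : ℝ) * g (x i)| = (1 / N : ℝ) * |g (x i)| := fun i => by
      rw [abs_mul, abs_of_nonneg (by positivity)]
    simp only [this]
    rw [← Finset.mul_sum]
    ring
  rw [eg, eg2] at hg
  have hpos : 0 ≤ γ * ∑ i, |β1 i| := by positivity
  change empErr x y (gcomb x σ β1) + _ ≤ _ at hg
  rw [← mul_assoc] at hhol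
  linarith
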